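/- Let m ≤ n be integers and let (T_k), (σ¹_k), (σ²_k) be real numbers for m ≤ k ≤ n, with σ¹_k, σ²_k ≥ 0. Define D¹ and D² recursively by D¹(m) = T_m + σ¹_m, D²(m) = D¹(m) + σ²_m, and for m < k ≤ n: D¹(k) = max(D¹(k−1), T_k) + σ¹_k and D²(k) = max(D²(k−1), D¹(k)) + σ²_k. Then for every m ≤ k ≤ n: D¹(k) = max_{m ≤ j ≤ k} ( T_j + Σ_{i=j}^{k} σ¹_i ) and D²(k) = max_{m ≤ j ≤ k} ( T_j + max_{j ≤ ℓ ≤ k} ( Σ_{i=j}^{ℓ} σ¹_i + Σ_{i=ℓ}^{k} σ²_i ) ). In particular, the time of last activity of the tandem queue fed by customers m, …, n satisfies X_{[m,n]} = D²(n) = max_{m ≤ k ≤ n} ( T_k + max_{k ≤ i ≤ n} ( Σ_{j=k}^{i} σ¹_j + Σ_{j=i}^{n} σ²_j ) ). -/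

import Mathlib

theorem Int.sum_Icc_add_one_right {M : Type*} [AddCommMonoid M] (f : ℤ → M) {j k : ℤ}
    (hjk : j ≤ k + 1) :
    ∑ i ∈ Finset.Icc j (k + 1), f i = ∑ i ∈ Finset.Icc j k, f i + f (k + 1) := by
  rw [← Finset.insert_Icc_right_eq_Icc_add_one hjk, Finset.sum_insert (by simp), add_comm]

/-- Explicit solution of the recursion for the departure times `D` of a single-server FIFO queue
with arrival times `A` and service times `s`. -/
theorem departure_time_eq_sup' {m n : ℤ} {A s D : ℤ → ℝ} (hm : D m = A m + s m)
    (hD : ∀ k, m < k → k ≤ n → D k = max (D (k - 1)) (A k) + s k)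
    (k : ℤ) (hmk : m ≤ k) (hkn : k ≤ n) :
    D k = (Finset.Icc m k).sup' (Finset.nonempty_Icc.mpr hmk)
      (fun j => A j + ∑ i ∈ Finset.Icc j k, s i) := by
  induction k, hmk using Int.leInduction with
  | base => simp [hm]
  | succ k hmk ih =>
    have hstep := hD (k + 1) (by omega) hkn
    rw [add_sub_cancel_right, ih (by omega)] at hstep
    have hins := (Finset.insert_Icc_right_eq_Icc_add_one (hmk.trans (Int.le_add_one le_rfl))).symm
    have hsup : (Finset.Icc m k).sup' (Finset.nonempty_Icc.mpr hmk)
          (fun j => A j + ∑ i ∈ Finset.Icc j (k + 1), s i) =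
        (Finset.Icc m k).sup' (Finset.nonempty_Icc.mpr hmk)
          (fun j => A j + ∑ i ∈ Finset.Icc j k, s i) + s (k + 1) := by
      rw [Finset.sup'_add]
      refine Finset.sup'_congr _ rfl fun j hj => ?_
      rw [Int.sum_Icc_add_one_right s (by have := Finset.mem_Icc.mp hj; omega), add_assoc]
    simp only [hins]
    rw [Finset.sup'_insert (H := Finset.nonempty_Icc.mpr hmk), hsup, hstep,
      ← max_add_add_right, sup_comm]
    simp

/-- Explicit solution of the recursions for the departure times in a tandem
of two single-server FIFO queues fed by customers `m, …, n`:
`D¹(k) = max_{m ≤ j ≤ k} (T_j + Σ_{i=j}^k σ¹_i)` and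
`D²(k) = max_{m ≤ j ≤ k} (T_j + max_{j ≤ l ≤ k} (Σ_{i=j}^l σ¹_i + Σ_{i=l}^k σ²_i))`;
in particular the time of last activity is
`X_{[m,n]} = D²(n) = max_{m ≤ k ≤ n} (T_k + max_{k ≤ i ≤ n} (Σ_{j=k}^i σ¹_j + Σ_{j=i}^n σ²_j))`. -/
theorem tandem_departure_times
    (m n : ℤ) (hmn : m ≤ n)
    (T σ1 σ2 : ℤ → ℝ)
    (hσ1 : ∀ k, m ≤ k → k ≤ n → 0 ≤ σ1 k)
    (hσ2 : ∀ k, m ≤ k → k ≤ n → 0 ≤ σ2 k)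
    (D1 D2 : ℤ → ℝ)
    (hD1m : D1 m = T m + σ1 m)
    (hD2m : D2 m = D1 m + σ2 m)
    (hD1 : ∀ k, m < k → k ≤ n → D1 k = max (D1 (k - 1)) (T k) + σ1 k)
    (hD2 : ∀ k, m < k → k ≤ n → D2 k = max (D2 (k - 1)) (D1 k) + σ2 k) :
    (∀ (k : ℤ) (hmk : m ≤ k) (hkn : k ≤ n),
      D1 k = (Finset.Icc m k).sup' (Finset.nonempty_Icc.mpr hmk)
          (fun j => T j + ∑ i ∈ Finset.Icc j k, σ1 i) ∧
      D2 k = ((Finset.Icc m k).attach).sup'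
          (Finset.attach_nonempty_iff.mpr (Finset.nonempty_Icc.mpr hmk))
          (fun j => T j.1 +
            (Finset.Icc j.1 k).sup'
              (Finset.nonempty_Icc.mpr (Finset.mem_Icc.mp j.2).2)
              (fun l => (∑ i ∈ Finset.Icc j.1 l, σ1 i) +
                ∑ i ∈ Finset.Icc l k, σ2 i))) ∧
    D2 n = ((Finset.Icc m n).attach).sup'
        (Finset.attach_nonempty_iff.mpr (Finset.nonempty_Icc.mpr hmn))
        (fun k => T k.1 +
          (Finset.Icc k.1 n).sup'
            (Finset.nonempty_Icc.mpr (Finset.mem_Icc.mp k.2).2)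
            (fun i => (∑ j ∈ Finset.Icc k.1 i, σ1 j) +
              ∑ j ∈ Finset.Icc i n, σ2 j)) := by
  have hD1_eq := departure_time_eq_sup' hD1m hD1
  have hD2_eq := departure_time_eq_sup' hD2m hD2
  refine (fun h => ⟨h, (h n hmn le_rfl).2⟩) fun k hmk hkn => ⟨hD1_eq k hmk hkn, ?_⟩
  rw [hD2_eq k hmk hkn]
  apply le_antisymm
  · refine Finset.sup'_le _ _ fun l hl => ?_
    obtain ⟨hml, hlk⟩ := Finset.mem_Icc.mp hl
    rw [hD1_eq l hml (hlk.trans hkn), ← le_sub_iff_add_le]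
    refine Finset.sup'_le _ _ fun j hj => ?_
    obtain ⟨hmj, hjl⟩ := Finset.mem_Icc.mp hj
    rw [le_sub_iff_add_le, add_assoc]
    refine Finset.le_sup'_of_le _ (b := ⟨j, Finset.mem_Icc.mpr ⟨hmj, hjl.trans hlk⟩⟩)
      (Finset.mem_attach _ _) (add_le_add_right ?_ _)
    exact Finset.le_sup'_of_le _ (Finset.mem_Icc.mpr ⟨hjl, hlk⟩) le_rfl
  · refine Finset.sup'_le _ _ fun ⟨j, hj⟩ _ => ?_
    obtain ⟨hmj, hjk⟩ := Finset.mem_Icc.mp hj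
    rw [← le_sub_iff_add_le']
    refine Finset.sup'_le _ _ fun l hl => ?_
    obtain ⟨hjl, hlk⟩ := Finset.mem_Icc.mp hl
    rw [le_sub_iff_add_le', ← add_assoc]
    refine Finset.le_sup'_of_le _ (Finset.mem_Icc.mpr ⟨hmj.trans hjl, hlk⟩)
      (add_le_add_left ?_ _)
    rw [hD1_eq l (hmj.trans hjl) (hlk.trans hkn)]
    exact Finset.le_sup'_of_le _ (Finset.mem_Icc.mpr ⟨hmj, hjl⟩) le_rfl
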